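/- For all sets F1 and F2 of nonbasic features, if F̃1 ⊆ F̄2 then N(F1) ≤bool N(F2). -/

import Mathlib

namespace NavGraph

/-- The nonbasic features of the navigational algebra. -/
inductive Feature : Type
  | di | conv | inter | diff | proj | coproj
  deriving DecidableEq

/-- A graph over the label set `Λ`: it assigns to each label a binary relation
on the infinite universe of nodes (here `ℕ`). -/
def Graph (Λ : Type) : Type := Λ → Set (ℕ × ℕ)

/-- The active domain of a graph. -/
def adom {Λ : Type} (G : Graph Λ) : Set ℕ :=
  {m | ∃ n : ℕ, ∃ R : Λ, (m, n) ∈ G R ∨ (n, m) ∈ G R}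

/-- A graph is finite if each of its relations is finite. -/
def Graph.Finite {Λ : Type} (G : Graph Λ) : Prop := ∀ R : Λ, Set.Finite (G R)

/-- Expressions of the navigational algebra (with all nonbasic features). -/
inductive Expr (Λ : Type) : Type
  | rel (R : Λ)
  | empty
  | id
  | comp (e₁ e₂ : Expr Λ)
  | union (e₁ e₂ : Expr Λ)
  | di
  | conv (e : Expr Λ)
  | inter (e₁ e₂ : Expr Λ)
  | diff (e₁ e₂ : Expr Λ)
  | proj1 (e : Expr Λ)
  | proj2 (e : Expr Λ)
  | coproj1 (e : Expr Λ)
  | coproj2 (e : Expr Λ)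

/-- Semantics of expressions on graphs. -/
def eval {Λ : Type} : Expr Λ → Graph Λ → Set (ℕ × ℕ)
  | .rel R, G => G R
  | .empty, _ => ∅
  | .id, G => {p | p.1 = p.2 ∧ p.1 ∈ adom G}
  | .comp e₁ e₂, G => {p | ∃ z : ℕ, (p.1, z) ∈ eval e₁ G ∧ (z, p.2) ∈ eval e₂ G}
  | .union e₁ e₂, G => eval e₁ G ∪ eval e₂ G
  | .di, G => {p | p.1 ∈ adom G ∧ p.2 ∈ adom G ∧ p.1 ≠ p.2}
  | .conv e, G => {p | (p.2, p.1) ∈ eval e G}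
  | .inter e₁ e₂, G => eval e₁ G ∩ eval e₂ G
  | .diff e₁ e₂, G => eval e₁ G \ eval e₂ G
  | .proj1 e, G => {p | p.1 = p.2 ∧ p.1 ∈ adom G ∧ ∃ n : ℕ, (p.1, n) ∈ eval e G}
  | .proj2 e, G => {p | p.1 = p.2 ∧ p.1 ∈ adom G ∧ ∃ n : ℕ, (n, p.1) ∈ eval e G}
  | .coproj1 e, G => {p | p.1 = p.2 ∧ p.1 ∈ adom G ∧ ¬ ∃ n : ℕ, (p.1, n) ∈ eval e G}
  | .coproj2 e, G => {p | p.1 = p.2 ∧ p.1 ∈ adom G ∧ ¬ ∃ n : ℕ, (n, p.1) ∈ eval e G}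

/-- `e.InFrag F` holds if `e` is an expression of the language `N(F)`, i.e. it
only uses the basic operators and nonbasic features from `F`. -/
def Expr.InFrag {Λ : Type} (F : Set Feature) : Expr Λ → Prop
  | .rel _ => True
  | .empty => True
  | .id => True
  | .comp e₁ e₂ => e₁.InFrag F ∧ e₂.InFrag F
  | .union e₁ e₂ => e₁.InFrag F ∧ e₂.InFrag F
  | .di => Feature.di ∈ F
  | .conv e => Feature.conv ∈ F ∧ e.InFrag F
  | .inter e₁ e₂ => Feature.inter ∈ F ∧ e₁.InFrag F ∧ e₂.InFrag F
  | .diff e₁ e₂ => Feature.diff ∈ F ∧ e₁.InFrag F ∧ e₂.InFrag F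
  | .proj1 e => Feature.proj ∈ F ∧ e.InFrag F
  | .proj2 e => Feature.proj ∈ F ∧ e.InFrag F
  | .coproj1 e => Feature.coproj ∈ F ∧ e.InFrag F
  | .coproj2 e => Feature.coproj ∈ F ∧ e.InFrag F

/-- Membership in the closure `F̄` of a set of nonbasic features. -/
inductive InClosure (F : Set Feature) : Feature → Prop
  | base {x : Feature} : x ∈ F → InClosure F x
  | proj_of_coproj : InClosure F .coproj → InClosure F .proj
  | proj_of_inter_di : InClosure F .inter → InClosure F .di → InClosure F .proj
  | proj_of_inter_conv : InClosure F .inter → InClosure F .conv → InClosure F .proj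
  | coproj_of_diff_proj : InClosure F .diff → InClosure F .proj → InClosure F .coproj
  | inter_of_diff : InClosure F .diff → InClosure F .inter

/-- The closure `F̄` of a set of nonbasic features. -/
def closure (F : Set Feature) : Set Feature := {x | InClosure F x}

open Classical in
/-- The set `F̃`: replace converse by projection when converse is available but
intersection is not. -/
noncomputable def tilde (F : Set Feature) : Set Feature :=
  if Feature.conv ∈ closure F ∧ Feature.inter ∉ closure F then
    (F \ {Feature.conv}) ∪ {Feature.proj}
  else F

/-- `N(F₁) ≤path N(F₂)`: every path query expressible in `N(F₁)` is expressible
in `N(F₂)`. -/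
def leqPath (Λ : Type) (F₁ F₂ : Set Feature) : Prop :=
  ∀ e₁ : Expr Λ, e₁.InFrag F₁ →
    ∃ e₂ : Expr Λ, e₂.InFrag F₂ ∧ ∀ G : Graph Λ, eval e₂ G = eval e₁ G

/-- `N(F₁) ≤bool N(F₂)`: every boolean query expressible in `N(F₁)` is
expressible in `N(F₂)`. -/
def leqBool (Λ : Type) (F₁ F₂ : Set Feature) : Prop :=
  ∀ e₁ : Expr Λ, e₁.InFrag F₁ →
    ∃ e₂ : Expr Λ, e₂.InFrag F₂ ∧
      ∀ G : Graph Λ, ((eval e₂ G).Nonempty ↔ (eval e₁ G).Nonempty)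

/-- Strong separability at the level of boolean queries. -/
def StrongSepBool (Λ : Type) (F₁ F₂ : Set Feature) : Prop :=
  ∃ (e₁ : Expr Λ) (G₁ G₂ : Graph Λ), e₁.InFrag F₁ ∧ G₁.Finite ∧ G₂.Finite ∧
    (eval e₁ G₁).Nonempty ∧ ¬ (eval e₁ G₂).Nonempty ∧
    ∀ e₂ : Expr Λ, e₂.InFrag F₂ → ((eval e₂ G₁).Nonempty ↔ (eval e₂ G₂).Nonempty)

/-- Strong separability at the level of path queries. -/
def StrongSepPath (Λ : Type) (F₁ F₂ : Set Feature) : Prop :=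
  ∃ (e₁ : Expr Λ) (G : Graph Λ), e₁.InFrag F₁ ∧ G.Finite ∧
    ∀ e₂ : Expr Λ, e₂.InFrag F₂ → eval e₂ G ≠ eval e₁ G

/-- The `n`-fold composition `R ∘ ⋯ ∘ R` (with `R⁰ = id`). -/
def rpow {Λ : Type} (R : Λ) : ℕ → Expr Λ
  | 0 => .id
  | n + 1 => .comp (.rel R) (rpow R n)

/-- The degree of an expression: the maximum depth of nested applications of
composition, projection and coprojection. -/
def degree {Λ : Type} : Expr Λ → ℕ
  | .rel _ => 0
  | .empty => 0
  | .id => 0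
  | .di => 0
  | .comp e₁ e₂ => max (degree e₁) (degree e₂) + 1
  | .union e₁ e₂ => max (degree e₁) (degree e₂)
  | .conv e => degree e
  | .inter e₁ e₂ => max (degree e₁) (degree e₂)
  | .diff e₁ e₂ => max (degree e₁) (degree e₂)
  | .proj1 e => degree e + 1
  | .proj2 e => degree e + 1
  | .coproj1 e => degree e + 1
  | .coproj2 e => degree e + 1

end NavGraph

namespace NavGraph

variable {Λ : Type}

/-- `e` defines a relation on the active domain. -/
theorem eval_subset_adom (e : Expr Λ) (G : Graph Λ) {m n : ℕ} (h : (m, n) ∈ eval e G) :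
    m ∈ adom G ∧ n ∈ adom G := by
  induction e generalizing m n with
  | rel R => exact ⟨⟨n, R, .inl h⟩, ⟨m, R, .inr h⟩⟩
  | empty => exact h.elim
  | id => obtain ⟨rfl, h⟩ : m = n ∧ m ∈ adom G := h; exact ⟨h, h⟩
  | comp e₁ e₂ ih₁ ih₂ => obtain ⟨z, h₁, h₂⟩ := h; exact ⟨(ih₁ h₁).1, (ih₂ h₂).2⟩
  | union e₁ e₂ ih₁ ih₂ => exact h.elim ih₁ ih₂
  | di => exact ⟨h.1, h.2.1⟩
  | conv e ih => exact (ih h).symm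
  | inter e₁ e₂ ih₁ ih₂ => exact ih₁ h.1
  | diff e₁ e₂ ih₁ ih₂ => exact ih₁ h.1
  | proj1 e | proj2 e | coproj1 e | coproj2 e =>
    obtain ⟨hmn, h, -⟩ := h
    obtain rfl : m = n := hmn
    exact ⟨h, h⟩

/-- The path query `q` is expressible in `N(F)`. -/
def Expressible (F : Set Feature) (q : Graph Λ → Set (ℕ × ℕ)) : Prop :=
  ∃ e : Expr Λ, e.InFrag F ∧ ∀ G, eval e G = q G

/-- `N(F)` is closed, up to equivalence of path queries, under the operators of a feature. -/
def Supports (Λ : Type) (F : Set Feature) : Feature → Prop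
  | .di => Expressible F (eval (.di : Expr Λ))
  | .conv => ∀ e : Expr Λ, e.InFrag F → Expressible F (eval e.conv)
  | .inter => ∀ e₁ e₂ : Expr Λ, e₁.InFrag F → e₂.InFrag F →
      Expressible F (eval (e₁.inter e₂))
  | .diff => ∀ e₁ e₂ : Expr Λ, e₁.InFrag F → e₂.InFrag F →
      Expressible F (eval (e₁.diff e₂))
  | .proj => ∀ e : Expr Λ, e.InFrag F →
      Expressible F (eval e.proj1) ∧ Expressible F (eval e.proj2)
  | .coproj => ∀ e : Expr Λ, e.InFrag F →
      Expressible F (eval e.coproj1) ∧ Expressible F (eval e.coproj2)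

theorem supports_of_mem {F : Set Feature} {x : Feature} (hx : x ∈ F) : Supports Λ F x := by
  cases x with
  | di => exact ⟨.di, hx, fun _ => rfl⟩
  | conv => exact fun e he => ⟨.conv e, ⟨hx, he⟩, fun _ => rfl⟩
  | inter => exact fun e₁ e₂ h₁ h₂ => ⟨.inter e₁ e₂, ⟨hx, h₁, h₂⟩, fun _ => rfl⟩
  | diff => exact fun e₁ e₂ h₁ h₂ => ⟨.diff e₁ e₂, ⟨hx, h₁, h₂⟩, fun _ => rfl⟩
  | proj => exact fun e he =>
      ⟨⟨.proj1 e, ⟨hx, he⟩, fun _ => rfl⟩, ⟨.proj2 e, ⟨hx, he⟩, fun _ => rfl⟩⟩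
  | coproj => exact fun e he =>
      ⟨⟨.coproj1 e, ⟨hx, he⟩, fun _ => rfl⟩, ⟨.coproj2 e, ⟨hx, he⟩, fun _ => rfl⟩⟩

/-- `π₁(e) = π̄₁(π̄₁(e))`, and likewise for `π₂`. -/
theorem supports_proj_of_coproj {F : Set Feature} (h : Supports Λ F .coproj) :
    Supports Λ F .proj := by
  intro e he
  obtain ⟨⟨a, ha, hae⟩, ⟨b, hb, hbe⟩⟩ := h e he
  obtain ⟨c, hc, hce⟩ := (h a ha).1
  obtain ⟨d, hd, hde⟩ := (h b hb).1
  refine ⟨⟨c, hc, fun G => ?_⟩, ⟨d, hd, fun G => ?_⟩⟩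
  · ext ⟨m, n⟩
    simp only [hce, hae, eval, Set.mem_ofPred_eq]
    grind
  · ext ⟨m, n⟩
    simp only [hde, hbe, eval, Set.mem_ofPred_eq]
    grind

/-- `π₁(e) = (e ∘ (id ∪ di)) ∩ id`, and likewise for `π₂`. -/
theorem supports_proj_of_inter_di {F : Set Feature} (hi : Supports Λ F .inter)
    (hd : Supports Λ F .di) : Supports Λ F .proj := by
  intro e he
  obtain ⟨d, hdF, hde⟩ := hd
  obtain ⟨a, ha, hae⟩ := hi (.comp e (.union .id d)) .id ⟨he, trivial, hdF⟩ trivial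
  obtain ⟨b, hb, hbe⟩ := hi (.comp (.union .id d) e) .id ⟨⟨trivial, hdF⟩, he⟩ trivial
  refine ⟨⟨a, ha, fun G => ?_⟩, ⟨b, hb, fun G => ?_⟩⟩
  all_goals
    ext ⟨m, n⟩
    have := @eval_subset_adom _ e G
    simp only [hae, hbe, hde, eval, Set.mem_inter_iff, Set.mem_union, Set.mem_ofPred_eq]
    grind

/-- `π₁(e) = (e ∘ e⁻¹) ∩ id` and `π₂(e) = (e⁻¹ ∘ e) ∩ id`. -/
theorem supports_proj_of_inter_conv {F : Set Feature} (hi : Supports Λ F .inter)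
    (hc : Supports Λ F .conv) : Supports Λ F .proj := by
  intro e he
  obtain ⟨c, hcF, hce⟩ := hc e he
  obtain ⟨a, ha, hae⟩ := hi (.comp e c) .id ⟨he, hcF⟩ trivial
  obtain ⟨b, hb, hbe⟩ := hi (.comp c e) .id ⟨hcF, he⟩ trivial
  refine ⟨⟨a, ha, fun G => ?_⟩, ⟨b, hb, fun G => ?_⟩⟩
  all_goals
    ext ⟨m, n⟩
    simp only [hae, hbe, hce, eval, Set.mem_inter_iff, Set.mem_ofPred_eq]
    grind

/-- `π̄ᵢ(e) = id ∖ πᵢ(e)`. -/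
theorem supports_coproj_of_diff_proj {F : Set Feature} (hd : Supports Λ F .diff)
    (hp : Supports Λ F .proj) : Supports Λ F .coproj := by
  intro e he
  obtain ⟨⟨p, hpF, hpe⟩, ⟨q, hqF, hqe⟩⟩ := hp e he
  obtain ⟨a, ha, hae⟩ := hd .id p trivial hpF
  obtain ⟨b, hb, hbe⟩ := hd .id q trivial hqF
  refine ⟨⟨a, ha, fun G => ?_⟩, ⟨b, hb, fun G => ?_⟩⟩
  all_goals
    ext ⟨m, n⟩
    simp only [hae, hbe, hpe, hqe, eval, Set.mem_sdiff, Set.mem_ofPred_eq]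
    grind

/-- `e₁ ∩ e₂ = e₁ ∖ (e₁ ∖ e₂)`. -/
theorem supports_inter_of_diff {F : Set Feature} (hd : Supports Λ F .diff) :
    Supports Λ F .inter := by
  intro e₁ e₂ h₁ h₂
  obtain ⟨a, ha, hae⟩ := hd e₁ e₂ h₁ h₂
  obtain ⟨b, hb, hbe⟩ := hd e₁ a h₁ ha
  refine ⟨b, hb, fun G => ?_⟩
  simp only [hbe, hae, eval, sdiff_sdiff_right_self, Set.inf_eq_inter]

theorem supports_of_inClosure {F : Set Feature} {x : Feature} (hx : InClosure F x) :
    Supports Λ F x := by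
  induction hx with
  | base hx => exact supports_of_mem hx
  | proj_of_coproj _ ih => exact supports_proj_of_coproj ih
  | proj_of_inter_di _ _ ih₁ ih₂ => exact supports_proj_of_inter_di ih₁ ih₂
  | proj_of_inter_conv _ _ ih₁ ih₂ => exact supports_proj_of_inter_conv ih₁ ih₂
  | coproj_of_diff_proj _ _ ih₁ ih₂ => exact supports_coproj_of_diff_proj ih₁ ih₂
  | inter_of_diff _ ih => exact supports_inter_of_diff ih

theorem leqPath_of_subset_closure {F₁ F₂ : Set Feature} (h : F₁ ⊆ closure F₂) :
    leqPath Λ F₁ F₂ := by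
  have sup {x : Feature} (hx : x ∈ F₁) : Supports Λ F₂ x := supports_of_inClosure (h hx)
  intro e he
  induction e with
  | rel R => exact ⟨.rel R, trivial, fun _ => rfl⟩
  | empty => exact ⟨.empty, trivial, fun _ => rfl⟩
  | id => exact ⟨.id, trivial, fun _ => rfl⟩
  | di => exact sup he
  | comp e₁ e₂ ih₁ ih₂ =>
    obtain ⟨a, ha, hae⟩ := ih₁ he.1
    obtain ⟨b, hb, hbe⟩ := ih₂ he.2
    exact ⟨.comp a b, ⟨ha, hb⟩, fun G => by simp only [eval, hae, hbe]⟩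
  | union e₁ e₂ ih₁ ih₂ =>
    obtain ⟨a, ha, hae⟩ := ih₁ he.1
    obtain ⟨b, hb, hbe⟩ := ih₂ he.2
    exact ⟨.union a b, ⟨ha, hb⟩, fun G => by simp only [eval, hae, hbe]⟩
  | conv e ih =>
    obtain ⟨a, ha, hae⟩ := ih he.2
    obtain ⟨b, hb, hbe⟩ := sup he.1 a ha
    exact ⟨b, hb, fun G => by simp only [hbe, eval, hae]⟩
  | inter e₁ e₂ ih₁ ih₂ =>
    obtain ⟨a, ha, hae⟩ := ih₁ he.2.1
    obtain ⟨b, hb, hbe⟩ := ih₂ he.2.2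
    obtain ⟨c, hc, hce⟩ := sup he.1 a b ha hb
    exact ⟨c, hc, fun G => by simp only [hce, eval, hae, hbe]⟩
  | diff e₁ e₂ ih₁ ih₂ =>
    obtain ⟨a, ha, hae⟩ := ih₁ he.2.1
    obtain ⟨b, hb, hbe⟩ := ih₂ he.2.2
    obtain ⟨c, hc, hce⟩ := sup he.1 a b ha hb
    exact ⟨c, hc, fun G => by simp only [hce, eval, hae, hbe]⟩
  | proj1 e ih =>
    obtain ⟨a, ha, hae⟩ := ih he.2
    obtain ⟨b, hb, hbe⟩ := (sup he.1 a ha).1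
    exact ⟨b, hb, fun G => by simp only [hbe, eval, hae]⟩
  | proj2 e ih =>
    obtain ⟨a, ha, hae⟩ := ih he.2
    obtain ⟨b, hb, hbe⟩ := (sup he.1 a ha).2
    exact ⟨b, hb, fun G => by simp only [hbe, eval, hae]⟩
  | coproj1 e ih =>
    obtain ⟨a, ha, hae⟩ := ih he.2
    obtain ⟨b, hb, hbe⟩ := (sup he.1 a ha).1
    exact ⟨b, hb, fun G => by simp only [hbe, eval, hae]⟩
  | coproj2 e ih =>
    obtain ⟨a, ha, hae⟩ := ih he.2
    obtain ⟨b, hb, hbe⟩ := (sup he.1 a ha).2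
    exact ⟨b, hb, fun G => by simp only [hbe, eval, hae]⟩

theorem leqPath.leqBool {F₁ F₂ : Set Feature} (h : leqPath Λ F₁ F₂) : leqBool Λ F₁ F₂ := by
  intro e he
  obtain ⟨e', he', heq⟩ := h e he
  exact ⟨e', he', fun G => by rw [heq G]⟩

theorem leqBool.trans {F₁ F₂ F₃ : Set Feature} (h₁ : leqBool Λ F₁ F₂) (h₂ : leqBool Λ F₂ F₃) :
    leqBool Λ F₁ F₃ := by
  intro e he
  obtain ⟨e', he', heq⟩ := h₁ e he
  obtain ⟨e'', he'', heq'⟩ := h₂ e' he'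
  exact ⟨e'', he'', fun G => (heq' G).trans (heq G)⟩

/-- The identity relation on the node set `P G` is expressible in `N(F)`. -/
def NodeExpressible (F : Set Feature) (P : Graph Λ → Set ℕ) : Prop :=
  Expressible F fun G => {p | p.1 = p.2 ∧ p.1 ∈ P G}

/-- The preimage of a set of nodes under `e`. -/
def preimage (e : Expr Λ) (P : Graph Λ → Set ℕ) (G : Graph Λ) : Set ℕ :=
  {m | ∃ n ∈ P G, (m, n) ∈ eval e G}

/-- The image of a set of nodes under `e`. -/
def image (e : Expr Λ) (P : Graph Λ → Set ℕ) (G : Graph Λ) : Set ℕ :=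
  {n | ∃ m ∈ P G, (m, n) ∈ eval e G}

namespace NodeExpressible

variable {F : Set Feature} {P Q : Graph Λ → Set ℕ}

theorem adom : NodeExpressible F (adom : Graph Λ → Set ℕ) := ⟨.id, trivial, fun _ => rfl⟩

theorem inter (hP : NodeExpressible F P) (hQ : NodeExpressible F Q) :
    NodeExpressible F fun G => P G ∩ Q G := by
  obtain ⟨φ, hφF, hφ⟩ := hP
  obtain ⟨ψ, hψF, hψ⟩ := hQ
  refine ⟨.comp φ ψ, ⟨hφF, hψF⟩, fun G => ?_⟩
  ext ⟨m, n⟩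
  simp only [eval, hφ, hψ, Set.mem_ofPred_eq, Set.mem_inter_iff]
  grind

theorem union (hP : NodeExpressible F P) (hQ : NodeExpressible F Q) :
    NodeExpressible F fun G => P G ∪ Q G := by
  obtain ⟨φ, hφF, hφ⟩ := hP
  obtain ⟨ψ, hψF, hψ⟩ := hQ
  refine ⟨.union φ ψ, ⟨hφF, hψF⟩, fun G => ?_⟩
  ext ⟨m, n⟩
  simp only [eval, hφ, hψ, Set.mem_ofPred_eq, Set.mem_union]
  grind

theorem compl (hc : Feature.coproj ∈ F) (hP : NodeExpressible F P) :
    NodeExpressible F fun G => NavGraph.adom G \ P G := by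
  obtain ⟨φ, hφF, hφ⟩ := hP
  refine ⟨.coproj1 φ, ⟨hc, hφF⟩, fun G => ?_⟩
  ext ⟨m, n⟩
  simp only [eval, hφ, Set.mem_ofPred_eq, Set.mem_sdiff]
  grind

theorem preimage_of_inFrag (hp : Feature.proj ∈ F) {e : Expr Λ} (he : e.InFrag F)
    (hP : NodeExpressible F P) : NodeExpressible F (preimage e P) := by
  obtain ⟨φ, hφF, hφ⟩ := hP
  refine ⟨.proj1 (.comp e φ), ⟨hp, he, hφF⟩, fun G => ?_⟩
  ext ⟨m, n⟩
  have := @eval_subset_adom _ e G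
  simp only [eval, hφ, preimage, Set.mem_ofPred_eq]
  grind

theorem image_of_inFrag (hp : Feature.proj ∈ F) {e : Expr Λ} (he : e.InFrag F)
    (hP : NodeExpressible F P) : NodeExpressible F (image e P) := by
  obtain ⟨φ, hφF, hφ⟩ := hP
  refine ⟨.proj2 (.comp φ e), ⟨hp, hφF, he⟩, fun G => ?_⟩
  ext ⟨m, n⟩
  have := @eval_subset_adom _ e G
  simp only [eval, hφ, image, Set.mem_ofPred_eq]
  grind

/-- A subidentity acts on node sets, in both directions, by intersection. -/
theorem preimage_image_of_subidentity {e : Expr Λ} (hQ : NodeExpressible F Q)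
    (heq : ∀ G, eval e G = {p | p.1 = p.2 ∧ p.1 ∈ Q G}) (hP : NodeExpressible F P) :
    NodeExpressible F (preimage e P) ∧ NodeExpressible F (image e P) := by
  have h₁ : preimage e P = fun G => P G ∩ Q G := by
    funext G
    ext m
    simp only [preimage, heq, Set.mem_ofPred_eq, Set.mem_inter_iff]
    grind
  have h₂ : image e P = fun G => P G ∩ Q G := by
    funext G
    ext m
    simp only [image, heq, Set.mem_ofPred_eq, Set.mem_inter_iff]
    grind
  rw [h₁, h₂]
  exact ⟨hP.inter hQ, hP.inter hQ⟩

/-- In the absence of intersection and difference, images and preimages of node sets under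
expressions with converse are expressible without converse. -/
theorem preimage_image (hi : Feature.inter ∉ F) (hd : Feature.diff ∉ F) {e : Expr Λ}
    (he : e.InFrag F) {P : Graph Λ → Set ℕ}
    (hP : NodeExpressible ((F \ {Feature.conv}) ∪ {Feature.proj}) P) :
    NodeExpressible ((F \ {Feature.conv}) ∪ {Feature.proj}) (preimage e P) ∧
      NodeExpressible ((F \ {Feature.conv}) ∪ {Feature.proj}) (image e P) := by
  have hp : Feature.proj ∈ (F \ {Feature.conv}) ∪ {Feature.proj} := .inr rfl
  induction e generalizing P with
  | rel R =>
    exact ⟨preimage_of_inFrag hp (e := .rel R) trivial hP,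
      image_of_inFrag hp (e := .rel R) trivial hP⟩
  | empty =>
    exact ⟨preimage_of_inFrag hp (e := .empty) trivial hP,
      image_of_inFrag hp (e := .empty) trivial hP⟩
  | id =>
    exact ⟨preimage_of_inFrag hp (e := .id) trivial hP,
      image_of_inFrag hp (e := .id) trivial hP⟩
  | di =>
    have he' : (Expr.di : Expr Λ).InFrag ((F \ {Feature.conv}) ∪ {Feature.proj}) :=
      .inl ⟨he, by simp⟩
    exact ⟨preimage_of_inFrag hp he' hP, image_of_inFrag hp he' hP⟩
  | comp e₁ e₂ ih₁ ih₂ =>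
    have h₁ : preimage (e₁.comp e₂) P = preimage e₁ (preimage e₂ P) := by
      funext G
      ext m
      simp only [preimage, eval, Set.mem_ofPred_eq]
      grind
    have h₂ : image (e₁.comp e₂) P = image e₂ (image e₁ P) := by
      funext G
      ext m
      simp only [image, eval, Set.mem_ofPred_eq]
      grind
    rw [h₁, h₂]
    exact ⟨(ih₁ he.1 (ih₂ he.2 hP).1).1, (ih₂ he.2 (ih₁ he.1 hP).2).2⟩
  | union e₁ e₂ ih₁ ih₂ =>
    have h₁ : preimage (e₁.union e₂) P = fun G => preimage e₁ P G ∪ preimage e₂ P G := by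
      funext G
      ext m
      simp only [preimage, eval, Set.mem_ofPred_eq, Set.mem_union]
      grind
    have h₂ : image (e₁.union e₂) P = fun G => image e₁ P G ∪ image e₂ P G := by
      funext G
      ext m
      simp only [image, eval, Set.mem_ofPred_eq, Set.mem_union]
      grind
    rw [h₁, h₂]
    exact ⟨(ih₁ he.1 hP).1.union (ih₂ he.2 hP).1, (ih₁ he.1 hP).2.union (ih₂ he.2 hP).2⟩
  | conv e ih => exact (ih he.2 hP).symm
  | inter e₁ e₂ => exact (hi he.1).elim
  | diff e₁ e₂ => exact (hd he.1).elim
  | proj1 e ih =>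
    refine preimage_image_of_subidentity (ih he.2 adom).1 (fun G => ?_) hP
    ext ⟨m, n⟩
    have := @eval_subset_adom _ e G
    simp only [eval, preimage, Set.mem_ofPred_eq]
    grind
  | proj2 e ih =>
    refine preimage_image_of_subidentity (ih he.2 adom).2 (fun G => ?_) hP
    ext ⟨m, n⟩
    have := @eval_subset_adom _ e G
    simp only [eval, image, Set.mem_ofPred_eq]
    grind
  | coproj1 e ih =>
    refine preimage_image_of_subidentity
      ((ih he.2 adom).1.compl (.inl ⟨he.1, by simp⟩)) (fun G => ?_) hP
    ext ⟨m, n⟩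
    have := @eval_subset_adom _ e G
    simp only [eval, preimage, Set.mem_ofPred_eq, Set.mem_sdiff]
    grind
  | coproj2 e ih =>
    refine preimage_image_of_subidentity
      ((ih he.2 adom).2.compl (.inl ⟨he.1, by simp⟩)) (fun G => ?_) hP
    ext ⟨m, n⟩
    have := @eval_subset_adom _ e G
    simp only [eval, image, Set.mem_ofPred_eq, Set.mem_sdiff]
    grind

end NodeExpressible

/-- Without intersection and difference, converse can be replaced by projection at the level of
boolean queries. -/
theorem leqBool_replace_conv {F : Set Feature} (hi : Feature.inter ∉ F) (hd : Feature.diff ∉ F) :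
    leqBool Λ F ((F \ {Feature.conv}) ∪ {Feature.proj}) := by
  intro e he
  obtain ⟨φ, hφF, hφ⟩ := (NodeExpressible.preimage_image hi hd he NodeExpressible.adom).1
  refine ⟨φ, hφF, fun G => ?_⟩
  rw [hφ]
  constructor
  · rintro ⟨⟨m, _⟩, _, n, _, h⟩
    exact ⟨(m, n), h⟩
  · rintro ⟨⟨m, n⟩, h⟩
    exact ⟨(m, m), rfl, n, (eval_subset_adom e G h).2, h⟩

/-- If `F̃₁ ⊆ F̄₂` then `N(F₁) ≤bool N(F₂)`. -/
theorem bool_if_tilde_subset (Λ : Type) [Fintype Λ] [Nonempty Λ]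
    (F₁ F₂ : Set Feature) (h : tilde F₁ ⊆ closure F₂) :
    leqBool Λ F₁ F₂ := by
  unfold tilde at h
  split_ifs at h with hF
  · have hi : Feature.inter ∉ F₁ := fun hx => hF.2 (.base hx)
    have hd : Feature.diff ∉ F₁ := fun hx => hF.2 (.inter_of_diff (.base hx))
    exact (leqBool_replace_conv hi hd).trans (leqPath_of_subset_closure h).leqBool
  · exact (leqPath_of_subset_closure h).leqBool

end NavGraph
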